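/- arXiv:2401.07804 — 2 statements merged into one kernel-verified Lean document; each statement's English description precedes it below -/
import Mathlib

section
/- Let I be a nonempty set and let U(I) be the set of all finitely additive probability charges on I, regarded as a convex subset of the real vector space of all real-valued functions on the power set of I. Then a charge m ∈ U(I) is an extreme point of U(I) if and only if m(A) ∈ {0, 1} for every A ⊆ I. -/
/-- A finitely additive probability charge on a set `I`: a nonnegative, finitely
additive function on all subsets of `I` with total mass `1`. -/
def IsProbCharge {I : Type*} (m : Set I → ℝ) : Prop :=
  (∀ A : Set I, 0 ≤ m A) ∧ m Set.univ = 1 ∧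
    ∀ A B : Set I, Disjoint A B → m (A ∪ B) = m A + m B

namespace IsProbCharge

variable {I : Type*} {m : Set I → ℝ}

lemma add_compl (hm : IsProbCharge m) (A : Set I) : m A + m Aᶜ = 1 := by
  rw [← hm.2.2 A Aᶜ disjoint_compl_right, Set.union_compl_self, hm.2.1]

lemma le_one (hm : IsProbCharge m) (A : Set I) : m A ≤ 1 := by
  linarith [hm.add_compl A, hm.1 Aᶜ]

/-- The charge `m` conditioned on a set of positive mass. -/
lemma cond (hm : IsProbCharge m) {A : Set I} (hA : 0 < m A) :
    IsProbCharge fun B => m (B ∩ A) / m A := by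
  refine ⟨fun B => div_nonneg (hm.1 _) hA.le, ?_, fun B C hBC => ?_⟩
  · simp [hA.ne']
  · beta_reduce
    rw [Set.union_inter_distrib_right,
      hm.2.2 _ _ (hBC.mono Set.inter_subset_left Set.inter_subset_left), add_div]

/-- A set of mass strictly between `0` and `1` splits the charge into a proper convex
combination of its two conditional charges. -/
lemma mem_openSegment_cond (hm : IsProbCharge m) {A : Set I} (hA : 0 < m A) (hAc : 0 < m Aᶜ) :
    m ∈ openSegment ℝ (fun B => m (B ∩ A) / m A) (fun B => m (B ∩ Aᶜ) / m Aᶜ) := by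
  refine ⟨m A, m Aᶜ, hA, hAc, hm.add_compl A, funext fun B => ?_⟩
  have h := hm.2.2 (B ∩ A) (B ∩ Aᶜ)
    (disjoint_compl_right.mono Set.inter_subset_right Set.inter_subset_right)
  rw [Set.inter_union_compl] at h
  simp only [Pi.add_apply, Pi.smul_apply, smul_eq_mul]
  rw [mul_div_cancel₀ _ hA.ne', mul_div_cancel₀ _ hAc.ne', h]

end IsProbCharge

/-- A finitely additive probability charge `m` on a nonempty set `I` is an extreme
point of the convex set of all such charges (inside the vector space of real-valued
functions on the power set of `I`) if and only if `m` takes only the values `0`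
and `1`. -/
theorem charge_extremePoint_iff_zero_one
    (I : Type*) [Nonempty I] (m : Set I → ℝ) (hm : IsProbCharge m) :
    m ∈ Set.extremePoints ℝ {μ : Set I → ℝ | IsProbCharge μ} ↔
      ∀ A : Set I, m A = 0 ∨ m A = 1 := by
  constructor
  · intro h A
    by_contra! hA
    have hpos : 0 < m A := (hm.1 A).lt_of_ne' hA.1
    have hlt : m A < 1 := (hm.le_one A).lt_of_ne hA.2
    have hcpos : 0 < m Aᶜ := by linarith [hm.add_compl A]
    have heq := congrFun (h.2 (hm.cond hpos) (hm.cond hcpos) (hm.mem_openSegment_cond hpos hcpos)) A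
    simp only [Set.inter_self, div_self hpos.ne'] at heq
    exact hA.2 heq.symm
  · refine fun h => ⟨hm, ?_⟩
    rintro μ (hμ : IsProbCharge μ) ν (hν : IsProbCharge ν) ⟨a, b, ha, hb, hab, hmix⟩
    funext A
    have hA : a * μ A + b * ν A = m A := congrFun hmix A
    rcases h A with h0 | h1
    · have := hν.1 A
      have := hμ.1 A
      rw [h0] at hA ⊢
      nlinarith
    · have := hν.le_one A
      have := hμ.le_one A
      rw [h1] at hA ⊢
      nlinarith
end

section
/- Let S be the unit circle in the Euclidean plane ℝ², and let K ⊆ S be a nonempty closed subset with the following property: for all a, b ∈ K (possibly equal), every point x ∈ S that maximizes the function y ↦ ‖y − a‖ + ‖y − b‖ over S belongs to K. Then K = S. -/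
/-- The point of the unit circle at angle `t`. -/
noncomputable def circlePoint (t : ℝ) : EuclideanSpace ℝ (Fin 2) := !₂[Real.cos t, Real.sin t]

lemma continuous_circlePoint : Continuous circlePoint := by
  unfold circlePoint
  refine (PiLp.continuous_toLp 2 _).comp (continuous_pi fun i => ?_)
  fin_cases i
  · exact Real.continuous_cos
  · exact Real.continuous_sin

lemma circlePoint_add_two_pi (t : ℝ) : circlePoint (t + 2 * Real.pi) = circlePoint t := by
  simp [circlePoint]

lemma circlePoint_mem_sphere (t : ℝ) :
    circlePoint t ∈ Metric.sphere (0 : EuclideanSpace ℝ (Fin 2)) 1 := by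
  simp [circlePoint, EuclideanSpace.norm_eq, Fin.sum_univ_two]

lemma exists_circlePoint_eq {x : EuclideanSpace ℝ (Fin 2)}
    (hx : x ∈ Metric.sphere (0 : EuclideanSpace ℝ (Fin 2)) 1) : ∃ t, circlePoint t = x := by
  have hz : ‖(⟨x 0, x 1⟩ : ℂ)‖ = 1 := by
    rw [mem_sphere_zero_iff_norm, EuclideanSpace.norm_eq, Fin.sum_univ_two] at hx
    rw [Complex.norm_eq_sqrt_sq_add_sq]
    simpa using hx
  have hc := Complex.norm_mul_cos_arg ⟨x 0, x 1⟩
  have hs := Complex.norm_mul_sin_arg ⟨x 0, x 1⟩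
  rw [hz, one_mul] at hc hs
  refine ⟨Complex.arg ⟨x 0, x 1⟩, ?_⟩
  ext i
  fin_cases i
  · exact hc
  · exact hs

/-- The chord length between two points of the unit circle. -/
lemma norm_circlePoint_sub (s t : ℝ) :
    ‖circlePoint s - circlePoint t‖ = 2 * |Real.sin ((s - t) / 2)| := by
  have h : (Real.cos s - Real.cos t) ^ 2 + (Real.sin s - Real.sin t) ^ 2 =
      (2 * Real.sin ((s - t) / 2)) ^ 2 := by
    rw [Real.cos_sub_cos, Real.sin_sub_sin]
    linear_combination 4 * Real.sin ((s - t) / 2) ^ 2 * Real.sin_sq_add_cos_sq ((s + t) / 2)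
  have h2 : ‖circlePoint s - circlePoint t‖ = √((2 * Real.sin ((s - t) / 2)) ^ 2) := by
    rw [EuclideanSpace.norm_eq, Fin.sum_univ_two, ← h]
    simp [circlePoint]
  rw [h2, Real.sqrt_sq_eq_abs, abs_mul, abs_two]

/-- With `u` and `d` the half-sum and half-difference of the two angles, `|sin (u - d)| +
|sin (u + d)|` is bounded uniformly in `u`. -/
lemma abs_sin_sub_add_abs_sin_add_le (u d : ℝ) :
    |Real.sin (u - d)| + |Real.sin (u + d)| ≤ 2 * max |Real.sin d| |Real.cos d| := by
  have key : ∀ x y : ℝ, |x| ≤ 1 → 2 * (x * y) ≤ 2 * |y| := fun x y hx => by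
    have := mul_le_mul_of_nonneg_right hx (abs_nonneg y)
    have := le_abs_self (x * y)
    rw [abs_mul] at this
    linarith
  have h1 := key _ (Real.cos d) (Real.abs_sin_le_one u)
  have h2 := key _ (Real.sin d) (Real.abs_cos_le_one u)
  have h3 := key (-Real.sin u) (Real.cos d) (by rw [abs_neg]; exact Real.abs_sin_le_one u)
  have h4 := key (-Real.cos u) (Real.sin d) (by rw [abs_neg]; exact Real.abs_cos_le_one u)
  have h5 := le_max_left |Real.sin d| |Real.cos d|
  have h6 := le_max_right |Real.sin d| |Real.cos d|
  rw [Real.sin_sub, Real.sin_add]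
  rcases abs_cases (Real.sin u * Real.cos d - Real.cos u * Real.sin d) with ⟨h, -⟩ | ⟨h, -⟩ <;>
  rcases abs_cases (Real.sin u * Real.cos d + Real.cos u * Real.sin d) with ⟨h', -⟩ | ⟨h', -⟩ <;>
  rw [h, h'] <;> linarith

/-- For two points of the unit circle, the sum of the distances to them is maximized over the
circle at one of the two points halfway between them. -/
lemma circlePoint_midpoint_maximizes (s t : ℝ) :
    (∀ y ∈ Metric.sphere (0 : EuclideanSpace ℝ (Fin 2)) 1,
        ‖y - circlePoint s‖ + ‖y - circlePoint t‖ ≤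
          ‖circlePoint ((s + t) / 2 + Real.pi) - circlePoint s‖ +
          ‖circlePoint ((s + t) / 2 + Real.pi) - circlePoint t‖) ∨
    (|Real.cos ((s - t) / 4)| < |Real.sin ((s - t) / 4)| ∧
      ∀ y ∈ Metric.sphere (0 : EuclideanSpace ℝ (Fin 2)) 1,
        ‖y - circlePoint s‖ + ‖y - circlePoint t‖ ≤
          ‖circlePoint ((s + t) / 2) - circlePoint s‖ +
          ‖circlePoint ((s + t) / 2) - circlePoint t‖) := by
  have bound : ∀ y ∈ Metric.sphere (0 : EuclideanSpace ℝ (Fin 2)) 1,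
      ‖y - circlePoint s‖ + ‖y - circlePoint t‖ ≤
        4 * max |Real.sin ((s - t) / 4)| |Real.cos ((s - t) / 4)| := by
    intro y hy
    obtain ⟨r, rfl⟩ := exists_circlePoint_eq hy
    have h := abs_sin_sub_add_abs_sin_add_le ((r - (s + t) / 2) / 2) ((s - t) / 4)
    rw [norm_circlePoint_sub, norm_circlePoint_sub,
      show (r - s) / 2 = (r - (s + t) / 2) / 2 - (s - t) / 4 by ring,
      show (r - t) / 2 = (r - (s + t) / 2) / 2 + (s - t) / 4 by ring]
    linarith
  rcases le_or_gt |Real.sin ((s - t) / 4)| |Real.cos ((s - t) / 4)| with h | h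
  · refine Or.inl fun y hy => (bound y hy).trans_eq ?_
    rw [max_eq_right h, norm_circlePoint_sub, norm_circlePoint_sub,
      show ((s + t) / 2 + Real.pi - s) / 2 = Real.pi / 2 - (s - t) / 4 by ring,
      show ((s + t) / 2 + Real.pi - t) / 2 = (s - t) / 4 + Real.pi / 2 by ring,
      Real.sin_pi_div_two_sub, Real.sin_add_pi_div_two]
    ring
  · refine Or.inr ⟨h, fun y hy => (bound y hy).trans_eq ?_⟩
    rw [max_eq_left h.le, norm_circlePoint_sub, norm_circlePoint_sub,
      show ((s + t) / 2 - s) / 2 = -((s - t) / 4) by ring,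
      show ((s + t) / 2 - t) / 2 = (s - t) / 4 by ring, Real.sin_neg, abs_neg]
    ring

/-- A closed set of reals, unbounded in both directions and stable under midpoints, is
everything. -/
lemma IsClosed.eq_univ_of_midpoint_mem {T : Set ℝ} (hT : IsClosed T)
    (hmid : ∀ s ∈ T, ∀ t ∈ T, (s + t) / 2 ∈ T)
    (hlow : ∀ x, ∃ t ∈ T, t ≤ x) (hup : ∀ x, ∃ t ∈ T, x ≤ t) : T = Set.univ := by
  refine Set.eq_univ_of_forall fun x => ?_
  have hl : (T ∩ Set.Iic x).Nonempty := hlow x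
  have hu : (T ∩ Set.Ici x).Nonempty := hup x
  have bl : BddAbove (T ∩ Set.Iic x) := ⟨x, fun _ h => h.2⟩
  have bu : BddBelow (T ∩ Set.Ici x) := ⟨x, fun _ h => h.2⟩
  obtain ⟨ha, hax⟩ := (hT.inter isClosed_Iic).csSup_mem hl bl
  obtain ⟨hb, hbx⟩ := (hT.inter isClosed_Ici).csInf_mem hu bu
  have hm := hmid _ ha _ hb
  rw [Set.mem_Iic] at hax
  rw [Set.mem_Ici] at hbx
  rcases le_total ((sSup (T ∩ Set.Iic x) + sInf (T ∩ Set.Ici x)) / 2) x with h | h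
  · have := le_csSup bl ⟨hm, h⟩
    rwa [show x = sSup (T ∩ Set.Iic x) by linarith]
  · have := csInf_le bu ⟨hm, h⟩
    rwa [show x = sInf (T ∩ Set.Ici x) by linarith]

/-- Minimality of the unit circle: if `K` is a nonempty closed subset of the unit
circle `S ⊆ ℝ²` such that for all `a, b ∈ K`, every point of `S` maximizing
`y ↦ ‖y - a‖ + ‖y - b‖` over `S` belongs to `K`, then `K = S`. -/
theorem unit_circle_minimal
    (K : Set (EuclideanSpace ℝ (Fin 2)))
    (hKS : K ⊆ Metric.sphere (0 : EuclideanSpace ℝ (Fin 2)) 1)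
    (hne : K.Nonempty) (hcl : IsClosed K)
    (hmax : ∀ a ∈ K, ∀ b ∈ K, ∀ x ∈ Metric.sphere (0 : EuclideanSpace ℝ (Fin 2)) 1,
      (∀ y ∈ Metric.sphere (0 : EuclideanSpace ℝ (Fin 2)) 1,
        ‖y - a‖ + ‖y - b‖ ≤ ‖x - a‖ + ‖x - b‖) → x ∈ K) :
    K = Metric.sphere (0 : EuclideanSpace ℝ (Fin 2)) 1 := by
  have hanti : ∀ t, circlePoint t ∈ K → circlePoint (t + Real.pi) ∈ K := by
    intro t ht
    rcases circlePoint_midpoint_maximizes t t with h | ⟨h, -⟩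
    · rw [add_self_div_two] at h
      exact hmax _ ht _ ht _ (circlePoint_mem_sphere _) h
    · norm_num at h
  have hmid : ∀ s ∈ circlePoint ⁻¹' K, ∀ t ∈ circlePoint ⁻¹' K,
      (s + t) / 2 ∈ circlePoint ⁻¹' K := by
    intro s hs t ht
    rcases circlePoint_midpoint_maximizes s t with h | ⟨-, h⟩
    · have := hanti _ (hmax _ hs _ ht _ (circlePoint_mem_sphere _) h)
      rwa [add_assoc, ← two_mul, circlePoint_add_two_pi] at this
    · exact hmax _ hs _ ht _ (circlePoint_mem_sphere _) h
  obtain ⟨a, ha⟩ := hne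
  obtain ⟨t, rfl⟩ := exists_circlePoint_eq (hKS ha)
  have hper : Function.Periodic circlePoint (2 * Real.pi) := circlePoint_add_two_pi
  have huniv : circlePoint ⁻¹' K = Set.univ := by
    refine (hcl.preimage continuous_circlePoint).eq_univ_of_midpoint_mem hmid
      (fun x => ?_) fun x => ?_
    · obtain ⟨r, hr, h⟩ := hper.exists_mem_Ico Real.two_pi_pos t (x - 2 * Real.pi)
      exact ⟨r, by rwa [Set.mem_preimage, ← h], by linarith [hr.2]⟩
    · obtain ⟨r, hr, h⟩ := hper.exists_mem_Ico Real.two_pi_pos t x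
      exact ⟨r, by rwa [Set.mem_preimage, ← h], hr.1⟩
  refine hKS.antisymm fun x hx => ?_
  obtain ⟨r, rfl⟩ := exists_circlePoint_eq hx
  exact huniv.ge (Set.mem_univ r)
end
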